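/- arXiv:0907.2315 — 9 statements merged into one kernel-verified Lean document; each statement's English description precedes it below -/
import Mathlib

section
/- Assume Case 1. Then the state at time 27 satisfies: (s_(27,1),…,s_(27,93)) = (k_43,…,k_66, k_67+1, k_68+1, k_69, k_1,…,k_66) (that is, s_(27,i) = k_{42+i} for 1 ≤ i ≤ 24, s_(27,25) = k_67+1, s_(27,26) = k_68+1, s_(27,27) = k_69, and s_(27,27+i) = k_i for 1 ≤ i ≤ 66); s_(27,j) = 0 for 162 ≤ j ≤ 177; and s_(27,j) = 0 for 178 ≤ j ≤ 288. -/
/-- A Trivium state: we use coordinates 1,…,288 of a function `ℕ → ZMod 2`. -/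
abbrev TState := ℕ → ZMod 2

/-- The Trivium state-renewal map `T`. -/
def trivT (s : TState) : TState := fun j =>
  if j = 1 then s 243 + s 286 * s 287 + s 288 + s 69
  else if j ≤ 93 then s (j - 1)
  else if j = 94 then s 66 + s 91 * s 92 + s 93 + s 171
  else if j ≤ 177 then s (j - 1)
  else if j = 178 then s 162 + s 175 * s 176 + s 177 + s 264
  else if j ≤ 288 then s (j - 1)
  else 0

/-- `Z_F`: set every coordinate with index in `F` to zero. -/
def zapF (F : Finset ℕ) (s : TState) : TState := fun j => if j ∈ F then 0 else s j

/-- The loading state `L(k, IV)`: positions 1–93 are `(k_1,…,k_80,0,…,0)`,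
positions 94–177 are `(IV_1,…,IV_80,0,0,0,0)`, positions 178–288 are `(0,…,0,1,1,1)`. -/
def loadIV (k IV : TState) : TState := fun j =>
  if j = 0 then 0
  else if j ≤ 80 then k j
  else if j ≤ 93 then 0
  else if j ≤ 173 then IV (j - 93)
  else if j ≤ 285 then 0
  else if j ≤ 288 then 1
  else 0

/-- The fault-injected trajectory with initial vector `IV`:
`s^(0) = Z_F(L(k,IV))`, `s^(t+1) = Z_F(T(s^(t)))`. -/
def trajIV (F : Finset ℕ) (k IV : TState) : ℕ → TState
  | 0 => zapF F (loadIV k IV)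
  | t + 1 => zapF F (trivT (trajIV F k IV t))

/-- The fault-injected trajectory with `IV = 0`. -/
def traj (F : Finset ℕ) (k : TState) : ℕ → TState := trajIV F k (fun _ => 0)

/-- The key-stream with initial vector `IV`. -/
def ksIV (F : Finset ℕ) (k IV : TState) (m : ℕ) : ZMod 2 :=
  trajIV F k IV (m + 1152) 66 + trajIV F k IV (m + 1152) 93 + trajIV F k IV (m + 1152) 162 +
    trajIV F k IV (m + 1152) 177 + trajIV F k IV (m + 1152) 243 + trajIV F k IV (m + 1152) 288

/-- The key-stream with `IV = 0`. -/
def ks (F : Finset ℕ) (k : TState) : ℕ → ZMod 2 := ksIV F k (fun _ => 0)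

/-- `e_j` for `1 ≤ j ≤ 69`: `e_j = k_j` for `j ≤ 66`, `e_67 = k_67+1`, `e_68 = k_68+1`,
`e_69 = k_69`. -/
def ebase (k : TState) : ℕ → ZMod 2 := fun j =>
  if j ≤ 66 then k j else if j = 67 then k 67 + 1 else if j = 68 then k 68 + 1 else k 69

/-- `e` extended to all integer indices periodically with period 69. -/
def eper (k : TState) (i : ℤ) : ZMod 2 := ebase k (((i - 1).emod 69).toNat + 1)

/-- `a_n = s_(n-1,66) + s_(n-1,91)·s_(n-1,92) + s_(n-1,93)` for a natural number `n`. -/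
def aAt (F : Finset ℕ) (k : TState) (n : ℕ) : ZMod 2 :=
  traj F k (n - 1) 66 + traj F k (n - 1) 91 * traj F k (n - 1) 92 + traj F k (n - 1) 93

/-- The sequence `a_i` for integer `i`: `a_{t+1} = s_(t,66)+s_(t,91)s_(t,92)+s_(t,93)` for
`t ≥ 27`, and for `i ≤ 27`, `a_i = a_j` where `28 ≤ j ≤ 96` and `j ≡ i (mod 69)`. -/
def aFun (F : Finset ℕ) (k : TState) (i : ℤ) : ZMod 2 :=
  if 28 ≤ i then aAt F k i.toNat else aAt F k (28 + (i - 28).emod 69).toNat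

/-- `b_n = s_(n-1,162) + s_(n-1,175)·s_(n-1,176) + s_(n-1,177)` for a natural number `n`. -/
def bAt (F : Finset ℕ) (k : TState) (n : ℕ) : ZMod 2 :=
  traj F k (n - 1) 162 + traj F k (n - 1) 175 * traj F k (n - 1) 176 + traj F k (n - 1) 177

/-- The sequence `b_i` for integer `i`: `b_{t+1} = s_(t,162)+s_(t,175)s_(t,176)+s_(t,177)` for
`t ≥ 98`, and for `i ≤ 98`, `b_i = b_j` where `99 ≤ j ≤ 176` and `j ≡ i (mod 78)`. -/
def bFun (F : Finset ℕ) (k : TState) (i : ℤ) : ZMod 2 :=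
  if 99 ≤ i then bAt F k i.toNat else bAt F k (99 + (i - 99).emod 78).toNat

/-- The changed state at time 27 (Case 2, Lemma 6): coordinates 172–177 are replaced by
`s_(27,94)+a_27, …, s_(27,99)+a_22`; all other coordinates agree with `s^(27)`. -/
def sTildeBase (F : Finset ℕ) (k : TState) : TState := fun j =>
  if 172 ≤ j ∧ j ≤ 177 then traj F k 27 (j - 78) + aFun F k (199 - (j : ℤ))
  else traj F k 27 j

/-- The changed trajectory `s̃`: `s̃^(27)` is the changed state, and
`s̃^(t+1) = Z_F(T(s̃^(t)))` for `t ≥ 27`. (For `t ≤ 27`, `sTilde F k t = s̃^(27)`.) -/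
def sTilde (F : Finset ℕ) (k : TState) (t : ℕ) : TState :=
  (fun s => zapF F (trivT s))^[t - 27] (sTildeBase F k)

/-- The changed state at time 98 (Case 3, Lemma 11): coordinates 265–288 are replaced by
`s_(98,178)+b_98, …, s_(98,201)+b_75`; all other coordinates agree with `s^(98)`. -/
def sHatBase (F : Finset ℕ) (k : TState) : TState := fun j =>
  if 265 ≤ j ∧ j ≤ 288 then traj F k 98 (j - 87) + bFun F k (363 - (j : ℤ))
  else traj F k 98 j

/-- The changed trajectory `ŝ`: `ŝ^(98)` is the changed state, and
`ŝ^(t+1) = Z_F(T(ŝ^(t)))` for `t ≥ 98`. (For `t ≤ 98`, `sHat F k t = ŝ^(98)`.) -/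
def sHat (F : Finset ℕ) (k : TState) (t : ℕ) : TState :=
  (fun s => zapF F (trivT s))^[t - 98] (sHatBase F k)

/-- `aSeq t = a_{t+1} = s_(t,66) + s_(t,91)·s_(t,92) + s_(t,93)` for `t ≥ 0`. -/
def aSeq (F : Finset ℕ) (k : TState) (t : ℕ) : ZMod 2 :=
  traj F k t 66 + traj F k t 91 * traj F k t 92 + traj F k t 93

theorem traj_zero (F : Finset ℕ) (k : TState) (j : ℕ) :
    traj F k 0 j = if j ∈ F then 0 else loadIV k (fun _ => 0) j := rfl

theorem traj_succ (F : Finset ℕ) (k : TState) (t j : ℕ) :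
    traj F k (t + 1) j = if j ∈ F then 0 else trivT (traj F k t) j := rfl

/-- A fault at position `p` of the second register keeps that register zero from `p` on. -/
theorem traj_eq_zero_of_fault_le (k : TState) {F : Finset ℕ} {p : ℕ} (hp : p ∈ F) (h94 : 94 ≤ p)
    (t j : ℕ) (hpj : p ≤ j) (hj : j ≤ 177) : traj F k t j = 0 := by
  induction t generalizing j with
  | zero => grind [traj_zero, loadIV]
  | succ t ih =>
    rcases hpj.eq_or_lt with rfl | hlt
    · simp [traj_succ, hp]
    · have := ih (j - 1) (by omega) (by omega)
      grind [traj_succ, trivT]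

/-- With a fault in `{94, …, 162}`, the third register only shifts its loaded ones out. -/
theorem traj_third_register (k : TState) {F : Finset ℕ} {p : ℕ} (hp : p ∈ F) (h94 : 94 ≤ p)
    (h162 : p ≤ 162) (hsub : F ⊆ Finset.Icc 94 177) (t j : ℕ) (hlo : 178 ≤ j) (hhi : j ≤ 288) :
    traj F k t j = if 286 + t ≤ j then 1 else 0 := by
  have hjF : j ∉ F := fun h => by have := Finset.mem_Icc.mp (hsub h); omega
  induction t generalizing j with
  | zero => grind [traj_zero, loadIV]
  | succ t ih =>
    by_cases h178 : j = 178
    · subst h178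
      have second := traj_eq_zero_of_fault_le k hp h94 t
      have h264 := ih 264 (by omega) (by omega)
        (fun h => by have := Finset.mem_Icc.mp (hsub h); omega)
      rw [if_neg (by omega)] at h264
      rw [if_neg (by omega)]
      simp [traj_succ, trivT, h264, second 162 h162, second 175 (by omega),
        second 177 (by omega)]
    · have := ih (j - 1) (by omega) (by omega)
        (fun h => by have := Finset.mem_Icc.mp (hsub h); omega)
      have hs : traj F k (t + 1) j = traj F k t (j - 1) := by
        grind [traj_succ, trivT]
      rw [hs, this]
      grind

/-- The first register while the first key bits fed back through position 69 are shifted in. -/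
theorem traj_first_register (k : TState) {F : Finset ℕ} {p : ℕ} (hp : p ∈ F) (h94 : 94 ≤ p)
    (h162 : p ≤ 162) (hsub : F ⊆ Finset.Icc 94 177) (t j : ℕ) (ht : t ≤ 27) (hlo : 1 ≤ j)
    (hhi : j ≤ 93) (hkey : j ≤ 80 + t) :
    traj F k t j = if t < j then k (j - t) else
      k (69 + j - t) + if t = j + 1 ∨ t = j + 2 then 1 else 0 := by
  have hjF : j ∉ F := fun h => by have := Finset.mem_Icc.mp (hsub h); omega
  induction t generalizing j with
  | zero => grind [traj_zero, loadIV]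
  | succ t ih =>
    by_cases h1 : j = 1
    · subst h1
      have third := traj_third_register k hp h94 h162 hsub t
      have h69 := ih 69 (by omega) (by omega) (by omega) (by omega)
        (fun h => by have := Finset.mem_Icc.mp (hsub h); omega)
      rw [if_pos (by omega)] at h69
      simp only [traj_succ, if_neg hjF, trivT, if_true]
      rw [h69, third 243 (by omega) (by omega), third 286 (by omega) (by omega),
        third 287 (by omega) (by omega), third 288 (by omega) (by omega)]
      rcases t with _ | _ | _ | t
      · simp [CharTwo.add_self_eq_zero]
      · simp [add_comm]
      · simp [add_comm]
      · simp
        grind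
    · have := ih (j - 1) (by omega) (by omega) (by omega) (by omega)
        (fun h => by have := Finset.mem_Icc.mp (hsub h); omega)
      have hs : traj F k (t + 1) j = traj F k t (j - 1) := by
        grind [traj_succ, trivT]
      rw [hs, this]
      grind

/-- In Case 1, the state at time 27. -/
theorem case1_state_at_27 (k : TState) (F : Finset ℕ) (hF : F.Nonempty)
    (hsub : F ⊆ Finset.Icc 94 177)
    (hlo : 94 ≤ F.min' hF) (hhi : F.min' hF ≤ 162) :
    (∀ i, 1 ≤ i → i ≤ 24 → traj F k 27 i = k (42 + i)) ∧
    traj F k 27 25 = k 67 + 1 ∧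
    traj F k 27 26 = k 68 + 1 ∧
    traj F k 27 27 = k 69 ∧
    (∀ i, 1 ≤ i → i ≤ 66 → traj F k 27 (27 + i) = k i) ∧
    (∀ j, 162 ≤ j → j ≤ 177 → traj F k 27 j = 0) ∧
    (∀ j, 178 ≤ j → j ≤ 288 → traj F k 27 j = 0) := by
  have hp := F.min'_mem hF
  have first := fun j => traj_first_register k hp hlo hhi hsub 27 j le_rfl
  have third := traj_third_register k hp hlo hhi hsub 27
  refine ⟨fun i h1 h2 => ?_, ?_, ?_, ?_, fun i h1 h2 => ?_, fun j h1 h2 => ?_, fun j h1 h2 => ?_⟩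
  · rw [first i h1 (by omega) (by omega), if_neg (by omega), if_neg (by omega), add_zero]
    congr 1
    omega
  · simp [first 25]
  · simp [first 26]
  · simp [first 27]
  · rw [first (27 + i) (by omega) (by omega) (by omega), if_pos (by omega), Nat.add_sub_cancel_left]
  · exact traj_eq_zero_of_fault_le k hp hlo 27 j (hhi.trans h1) h2
  · rw [third j h1 h2, if_neg (by omega)]
end

section
/- Assume Case 2, and let s̃ denote the changed trajectory. Then: (1) for every t ≥ 33, s̃_(t,j) = s_(t,j) for all 1 ≤ j ≤ 177 and all 243 ≤ j ≤ 288; (2) the key-stream is unchanged: for every m ≥ 0, s̃_(m+1152,66) + s̃_(m+1152,93) + s̃_(m+1152,162) + s̃_(m+1152,177) + s̃_(m+1152,243) + s̃_(m+1152,288) = z_m. -/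
/-- One step of the fault-injected renewal map propagates agreement of two states on the
coordinates `j ≤ min b 177` and on the coordinates `j ≥ p`, for a fault position `p ≤ 243`, and
extends the former to `j ≤ min (b + 1) 177`. -/
theorem zapF_trivT_congr {F : Finset ℕ} {p b : ℕ} (hp : p ∈ F) (hlo : 178 ≤ p) (hhi : p ≤ 243)
    (hb : 171 ≤ b) {s s' : TState}
    (h : ∀ j, (j ≤ b ∧ j ≤ 177) ∨ p ≤ j → s j = s' j) (j : ℕ)
    (hj : (j ≤ b + 1 ∧ j ≤ 177) ∨ p ≤ j) :
    zapF F (trivT s) j = zapF F (trivT s') j := by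
  unfold zapF
  split_ifs with hjF
  · rfl
  have hjp : j ≠ p := fun e => hjF (e ▸ hp)
  unfold trivT
  split_ifs with h1 h2 h3 h4 h5 h6
  · rw [h 243 (by omega), h 286 (by omega), h 287 (by omega), h 288 (by omega), h 69 (by omega)]
  · exact h _ (by omega)
  · rw [h 66 (by omega), h 91 (by omega), h 92 (by omega), h 93 (by omega), h 171 (by omega)]
  · exact h _ (by omega)
  · omega
  · exact h _ (by omega)
  · rfl

/-- At time `27 + n` the changed trajectory agrees with the original one on the coordinates
`j ≤ min (171 + n) 177` and on all coordinates from a fault position `p ≤ 243` on. -/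
theorem sTilde_eq_traj {F : Finset ℕ} {p : ℕ} (k : TState) (hp : p ∈ F) (hlo : 178 ≤ p)
    (hhi : p ≤ 243) (n j : ℕ) (hj : (j ≤ 171 + n ∧ j ≤ 177) ∨ p ≤ j) :
    sTilde F k (27 + n) j = traj F k (27 + n) j := by
  induction n generalizing j with
  | zero =>
    have hj' : ¬(172 ≤ j ∧ j ≤ 177) := by omega
    simp [sTilde, sTildeBase, hj']
  | succ n ih =>
    have hs : sTilde F k (27 + (n + 1)) = zapF F (trivT (sTilde F k (27 + n))) := by
      simp only [sTilde, Nat.add_sub_cancel_left, Function.iterate_succ_apply']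
    rw [hs]
    exact zapF_trivT_congr hp hlo hhi (by omega) ih j hj

/-- Lemma 6 (Case 2): the changed trajectory agrees with the original one on
coordinates 1–177 and 243–288 from time 33 on, and the key-stream is unchanged. -/
theorem case2_changed_trajectory (k : TState) (F : Finset ℕ) (hF : F.Nonempty)
    (hsub : F ⊆ Finset.Icc 178 288)
    (hlo : 178 ≤ F.min' hF) (hhi : F.min' hF ≤ 243) :
    (∀ t, 33 ≤ t →
        (∀ j, 1 ≤ j → j ≤ 177 → sTilde F k t j = traj F k t j) ∧
        (∀ j, 243 ≤ j → j ≤ 288 → sTilde F k t j = traj F k t j)) ∧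
    (∀ m : ℕ,
        sTilde F k (m + 1152) 66 + sTilde F k (m + 1152) 93 + sTilde F k (m + 1152) 162 +
          sTilde F k (m + 1152) 177 + sTilde F k (m + 1152) 243 + sTilde F k (m + 1152) 288 =
          ks F k m) := by
  have key : ∀ t, 33 ≤ t → ∀ j, j ≤ 177 ∨ 243 ≤ j → sTilde F k t j = traj F k t j := by
    intro t ht j hj
    obtain ⟨n, rfl⟩ := Nat.exists_eq_add_of_le (show 27 ≤ t by omega)
    exact sTilde_eq_traj k (F.min'_mem hF) hlo hhi n j (by omega)
  refine ⟨fun t ht => ⟨fun j _ hj => key t ht j (.inl hj), fun j hj _ => key t ht j (.inr hj)⟩,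
    fun m => ?_⟩
  have hm : 33 ≤ m + 1152 := by omega
  rw [key _ hm 66 (by omega), key _ hm 93 (by omega), key _ hm 162 (by omega),
    key _ hm 177 (by omega), key _ hm 243 (by omega), key _ hm 288 (by omega)]
  rfl
end

section
/- Assume Case 3. Then: (1) for every t ≥ 92 and every 66 ≤ j ≤ 93, s_(t,j) = 0; (2) for every t ≥ 98 and every 1 ≤ i ≤ 6, s_(t,171+i) = s_(t,93+i); (3) for every t ≥ 98 and every 94 ≤ j ≤ 177, s_(t+78,j) = s_(t,j) (the second register has period 78 from time 98 on). -/
theorem traj_eq_zero_of_mem {F : Finset ℕ} {j : ℕ} (hj : j ∈ F) (k : TState) (t : ℕ) :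
    traj F k t j = 0 := by
  cases t with
  | zero => exact if_pos hj
  | succ t => rw [traj_succ, if_pos hj]

/-- A fault at `p` in the first register propagates zeros to the right, one position per step. -/
theorem traj_eq_zero_of_add {F : Finset ℕ} {p : ℕ} (hp : p ∈ F) (hp1 : 1 ≤ p) (k : TState)
    {d t : ℕ} (hd : p + d ≤ 93) (ht : d ≤ t) : traj F k t (p + d) = 0 := by
  induction d generalizing t with
  | zero => exact traj_eq_zero_of_mem hp k t
  | succ d ih =>
    obtain ⟨t, rfl⟩ : ∃ u, t = u + 1 := ⟨t - 1, by omega⟩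
    rw [traj_succ]
    split_ifs
    · rfl
    · rw [trivT, if_neg (by omega), if_pos hd]
      exact ih (by omega) (by omega)

/-- The second register shifts undisturbed when all faults lie in the first register. -/
theorem traj_shift {F : Finset ℕ} (hsub : F ⊆ Finset.Icc 1 93) (k : TState) (t : ℕ) {j d : ℕ}
    (hj : 94 ≤ j) (hd : j + d ≤ 177) : traj F k (t + d) (j + d) = traj F k t j := by
  induction d with
  | zero => rfl
  | succ d ih =>
    have hF : j + (d + 1) ∉ F := fun h => by
      have := Finset.mem_Icc.1 (hsub h)
      omega
    rw [← add_assoc t, traj_succ, if_neg hF, trivT, if_neg (by omega), if_neg (by omega),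
      if_neg (by omega), if_pos hd]
    exact ih (by omega)

/-- Lemma 9 (Case 3). -/
theorem case3_register_structure (k : TState) (F : Finset ℕ) (hF : F.Nonempty)
    (hsub : F ⊆ Finset.Icc 1 93)
    (hlo : 1 ≤ F.min' hF) (hhi : F.min' hF ≤ 66) :
    (∀ t, 92 ≤ t → ∀ j, 66 ≤ j → j ≤ 93 → traj F k t j = 0) ∧
    (∀ t, 98 ≤ t → ∀ i, 1 ≤ i → i ≤ 6 → traj F k t (171 + i) = traj F k t (93 + i)) ∧
    (∀ t, 98 ≤ t → ∀ j, 94 ≤ j → j ≤ 177 → traj F k (t + 78) j = traj F k t j) := by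
  have hmem := F.min'_mem hF
  have hzero : ∀ t, 92 ≤ t → ∀ j, 66 ≤ j → j ≤ 93 → traj F k t j = 0 := by
    intro t ht j hj hj'
    obtain ⟨d, rfl⟩ := Nat.exists_eq_add_of_le (hhi.trans hj)
    exact traj_eq_zero_of_add hmem hlo k hj' (by omega)
  have hfeed : ∀ t, 92 ≤ t → traj F k (t + 1) 94 = traj F k t 171 := by
    intro t ht
    have hF94 : 94 ∉ F := fun h => by simpa using hsub h
    rw [traj_succ, if_neg hF94]
    simp [trivT, hzero t ht]
  have htail : ∀ t, 98 ≤ t → ∀ i, 1 ≤ i → i ≤ 6 →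
      traj F k t (171 + i) = traj F k t (93 + i) := by
    intro t ht i hi hi'
    obtain ⟨u, rfl⟩ : ∃ u, t = u + i := ⟨t - i, by omega⟩
    obtain ⟨d, rfl⟩ : ∃ d, i = d + 1 := ⟨i - 1, by omega⟩
    rw [traj_shift hsub k u (by norm_num) (by omega), ← hfeed u (by omega),
      ← traj_shift hsub k (u + 1) (j := 94) (d := d) le_rfl (by omega),
      show u + 1 + d = u + (d + 1) by omega, show 94 + d = 93 + (d + 1) by omega]
  have hperiod : ∀ t, 98 ≤ t → ∀ j, 94 ≤ j → j ≤ 171 →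
      traj F k (t + 78) j = traj F k t j := by
    intro t ht j hj hj'
    obtain ⟨d, hd⟩ := Nat.exists_eq_add_of_le hj'
    obtain ⟨e, rfl⟩ := Nat.exists_eq_add_of_le hj
    rw [show t + 78 = t + d + 1 + e by omega,
      ← traj_shift hsub k t (j := 94 + e) (d := d) hj (by omega), ← hd,
      ← hfeed _ (by omega), ← traj_shift hsub k (t + d + 1) (j := 94) (d := e) le_rfl (by omega)]
  refine ⟨hzero, htail, fun t ht j hj hj' => ?_⟩
  rcases le_or_gt j 171 with h | h
  · exact hperiod t ht j hj h
  · obtain ⟨i, rfl⟩ := Nat.exists_eq_add_of_lt h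
    rw [add_assoc, htail _ (by omega) _ (by omega) (by omega), htail t ht _ (by omega) (by omega),
      hperiod t ht _ (by omega) (by omega)]
end

section
/- (Proposition 3, part 1) Assume Case 3. Then the key-stream (z_0, z_1, z_2, …) has period 4524, i.e. z_{m+4524} = z_m for every m ≥ 0. -/
/-- A sequence over `ZMod 2` driven with lag `p` by a `q`-periodic sequence has period `2 * n * p`
whenever `q ∣ n * p`: the sums of the driving terms over the two halves cancel. -/
theorem periodic_of_lag_recurrence {c g : ℕ → ZMod 2} {N p q n r : ℕ} (hn : n * p = r * q)
    (hc : ∀ u, N ≤ u → c (u + p) = c u + g u) (hg : ∀ u, N ≤ u → g (u + q) = g u)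
    {u : ℕ} (hu : N ≤ u) : c (u + 2 * n * p) = c u := by
  have hsum (m u : ℕ) (hu : N ≤ u) :
      c (u + m * p) = c u + ∑ i ∈ Finset.range m, g (u + i * p) := by
    induction m with
    | zero => simp
    | succ m ih =>
      rw [Finset.sum_range_succ, ← add_assoc, ← ih, ← hc _ (by omega)]
      congr 1
      ring
  have hmul (m u : ℕ) (hu : N ≤ u) : g (u + m * q) = g u := by
    induction m with
    | zero => simp
    | succ m ih => rw [add_mul, one_mul, ← add_assoc, hg _ (by omega), ih]
  have hhalf : ∑ i ∈ Finset.range n, g (u + n * p + i * p) =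
      ∑ i ∈ Finset.range n, g (u + i * p) :=
    Finset.sum_congr rfl fun i _ => by
      rw [hn, add_right_comm, hmul r _ (by omega)]
  rw [two_mul, add_mul, ← add_assoc, hsum n (u + n * p) (by omega), hhalf, hsum n u hu, add_assoc,
    CharTwo.add_self_eq_zero, add_zero]

section trajectory

variable {F : Finset ℕ} (k IV : TState)

theorem trajIV_succ_shift {j : ℕ} (hj : j + 1 ∉ F) (h0 : j ≠ 0) (h93 : j ≠ 93) (h177 : j ≠ 177)
    (h288 : j < 288) (t : ℕ) : trajIV F k IV (t + 1) (j + 1) = trajIV F k IV t j := by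
  simp only [trajIV, zapF, trivT, Nat.add_sub_cancel, if_neg hj]
  split_ifs <;> first | rfl | omega

theorem trajIV_eq_zero_of_mem {p : ℕ} (hp : p ∈ F) (t : ℕ) : trajIV F k IV t p = 0 := by
  cases t <;> simp [trajIV, zapF, hp]

theorem trajIV_eq_zero_of_le {p : ℕ} (hp : p ∈ F) (hp0 : p ≠ 0) (d t : ℕ) (hd : p + d ≤ 93)
    (ht : d ≤ t) : trajIV F k IV t (p + d) = 0 := by
  induction d generalizing t with
  | zero => exact trajIV_eq_zero_of_mem k IV hp t
  | succ d ih =>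
    obtain ⟨t, rfl⟩ : ∃ t', t = t' + 1 := ⟨t - 1, by omega⟩
    by_cases hj : p + d + 1 ∈ F
    · exact trajIV_eq_zero_of_mem k IV hj _
    · rw [← add_assoc, trajIV_succ_shift k IV hj (by omega) (by omega) (by omega) (by omega)]
      exact ih t (by omega) (by omega)

variable (hF : F ⊆ Finset.Icc 1 93)
include hF

theorem notMem_of_gt {j : ℕ} (hj : 93 < j) : j ∉ F := fun h => by
  have := Finset.mem_Icc.mp (hF h)
  omega

theorem trajIV_succ_94 (t : ℕ) : trajIV F k IV (t + 1) 94 =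
    trajIV F k IV t 66 + trajIV F k IV t 91 * trajIV F k IV t 92 + trajIV F k IV t 93 +
      trajIV F k IV t 171 := by
  simp [trajIV, zapF, trivT, notMem_of_gt hF (show 93 < 94 by norm_num)]

theorem trajIV_succ_178 (t : ℕ) : trajIV F k IV (t + 1) 178 =
    trajIV F k IV t 162 + trajIV F k IV t 175 * trajIV F k IV t 176 + trajIV F k IV t 177 +
      trajIV F k IV t 264 := by
  simp [trajIV, zapF, trivT, notMem_of_gt hF (show 93 < 178 by norm_num)]

theorem trajIV_second_register (t i : ℕ) (hi : i ≤ 83) :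
    trajIV F k IV (t + i) (94 + i) = trajIV F k IV t 94 := by
  induction i with
  | zero => rfl
  | succ i ih =>
    rw [← add_assoc, ← add_assoc, trajIV_succ_shift k IV (notMem_of_gt hF (by omega)) (by omega)
      (by omega) (by omega) (by omega), ih (by omega)]

theorem trajIV_third_register (t i : ℕ) (hi : i ≤ 110) :
    trajIV F k IV (t + i) (178 + i) = trajIV F k IV t 178 := by
  induction i with
  | zero => rfl
  | succ i ih =>
    rw [← add_assoc, ← add_assoc, trajIV_succ_shift k IV (notMem_of_gt hF (by omega)) (by omega)
      (by omega) (by omega) (by omega), ih (by omega)]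

theorem trajIV_third_register_recurrence (u : ℕ) :
    trajIV F k IV (u + 87) 178 = trajIV F k IV u 178 + (trajIV F k IV (u + 18) 94 +
      trajIV F k IV (u + 5) 94 * trajIV F k IV (u + 4) 94 + trajIV F k IV (u + 3) 94) := by
  have h178 := trajIV_succ_178 k IV hF (u + 86)
  rw [← trajIV_second_register k IV hF (u + 18) 68 (by norm_num),
    ← trajIV_second_register k IV hF (u + 5) 81 (by norm_num),
    ← trajIV_second_register k IV hF (u + 4) 82 (by norm_num),
    ← trajIV_second_register k IV hF (u + 3) 83 (by norm_num),
    ← trajIV_third_register k IV hF u 86 (by norm_num), add_comm (trajIV F k IV _ _)]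
  exact h178

variable {p : ℕ} (hp : p ∈ F) (hp66 : p ≤ 66)
include hp hp66

theorem trajIV_eq_zero_of_ge_66 {j t : ℕ} (h66 : 66 ≤ j) (h93 : j ≤ 93) (ht : 93 ≤ t) :
    trajIV F k IV t j = 0 := by
  have hp1 := (Finset.mem_Icc.mp (hF hp)).1
  obtain ⟨d, rfl⟩ := Nat.exists_eq_add_of_le (hp66.trans h66)
  exact trajIV_eq_zero_of_le k IV hp (by omega) d t h93 (by omega)

theorem trajIV_second_register_periodic {t : ℕ} (ht : 93 ≤ t) :
    trajIV F k IV (t + 78) 94 = trajIV F k IV t 94 := by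
  have hzero {j : ℕ} (h66 : 66 ≤ j) (h93 : j ≤ 93) : trajIV F k IV (t + 77) j = 0 :=
    trajIV_eq_zero_of_ge_66 k IV hF hp hp66 h66 h93 (by omega)
  have h94 := trajIV_succ_94 k IV hF (t + 77)
  rw [hzero le_rfl (by norm_num), hzero (j := 91) (by norm_num) (by norm_num),
    hzero (j := 93) (by norm_num) (by norm_num)] at h94
  rw [h94, ← trajIV_second_register k IV hF t 77 (by norm_num)]
  simp

theorem trajIV_second_register_periodic_4524 {t : ℕ} (ht : 93 ≤ t) :
    trajIV F k IV (t + 4524) 94 = trajIV F k IV t 94 := by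
  have h (m : ℕ) : trajIV F k IV (t + m * 78) 94 = trajIV F k IV t 94 := by
    induction m with
    | zero => simp
    | succ m ih =>
      rw [add_mul, one_mul, ← add_assoc,
        trajIV_second_register_periodic k IV hF hp hp66 (by omega), ih]
  exact h 58

theorem trajIV_third_register_periodic_4524 {t : ℕ} (ht : 93 ≤ t) :
    trajIV F k IV (t + 4524) 178 = trajIV F k IV t 178 := by
  refine periodic_of_lag_recurrence (c := fun t => trajIV F k IV t 178) (n := 26) (p := 87)
    (r := 29) (q := 78) (by norm_num)
    (fun u _ => trajIV_third_register_recurrence k IV hF u) (fun u hu => ?_) ht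
  have hB (i : ℕ) : trajIV F k IV (u + 78 + i) 94 = trajIV F k IV (u + i) 94 := by
    rw [add_right_comm, trajIV_second_register_periodic k IV hF hp hp66 (by omega)]
  simp only [hB]

theorem ksIV_periodic_4524 (m : ℕ) : ksIV F k IV (m + 4524) = ksIV F k IV m := by
  have hA {j : ℕ} (h66 : 66 ≤ j) (h93 : j ≤ 93) :
      trajIV F k IV (m + 4524 + 1152) j = trajIV F k IV (m + 1152) j := by
    rw [trajIV_eq_zero_of_ge_66 k IV hF hp hp66 h66 h93 (by omega),
      trajIV_eq_zero_of_ge_66 k IV hF hp hp66 h66 h93 (by omega)]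
  have hB (i : ℕ) (hi : i ≤ 83) :
      trajIV F k IV (m + 4524 + 1152) (94 + i) = trajIV F k IV (m + 1152) (94 + i) := by
    rw [show m + 4524 + 1152 = m + 1152 - i + 4524 + i by omega,
      trajIV_second_register k IV hF _ i hi,
      trajIV_second_register_periodic_4524 k IV hF hp hp66 (by omega),
      ← trajIV_second_register k IV hF _ i hi, Nat.sub_add_cancel (by omega)]
  have hC (i : ℕ) (hi : i ≤ 110) :
      trajIV F k IV (m + 4524 + 1152) (178 + i) = trajIV F k IV (m + 1152) (178 + i) := by
    rw [show m + 4524 + 1152 = m + 1152 - i + 4524 + i by omega,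
      trajIV_third_register k IV hF _ i hi,
      trajIV_third_register_periodic_4524 k IV hF hp hp66 (by omega),
      ← trajIV_third_register k IV hF _ i hi, Nat.sub_add_cancel (by omega)]
  simp only [ksIV, hA le_rfl (by norm_num), hA (j := 93) (by norm_num) le_rfl,
    hB 68 (by norm_num), hB 83 (by norm_num), hC 65 (by norm_num), hC 110 (by norm_num)]

end trajectory

/-- Proposition 3, part 1 (Case 3): the key-stream has period 4524. -/
theorem case3_keystream_period (k : TState) (F : Finset ℕ) (hF : F.Nonempty)
    (hsub : F ⊆ Finset.Icc 1 93)
    (hlo : 1 ≤ F.min' hF) (hhi : F.min' hF ≤ 66) :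
    ∀ m, ks F k (m + 4524) = ks F k m := ksIV_periodic_4524 k _ hsub (F.min'_mem hF) hhi
end

section
/- (Lemma 15) Let F be any nonempty hard-fault set and let j, m be integers with 1 ≤ j and j + m ≤ 93. If F ∩ {j, j+1, …, j+m} = ∅ (no hard-fault-injected bit has its index in {j,…,j+m}), then s_(m,j+m) = s_(0,j). -/
theorem traj_succ_of_notMem {F : Finset ℕ} {i : ℕ} (k : TState) (t : ℕ)
    (hi : 1 ≤ i) (hi' : i + 1 ≤ 93) (hF : i + 1 ∉ F) :
    traj F k (t + 1) (i + 1) = traj F k t i := by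
  have h1 : i + 1 ≠ 1 := by omega
  simp only [traj, trajIV, zapF, trivT, if_neg hF, if_neg h1, if_pos hi', Nat.add_sub_cancel]

/-- Lemma 15: if no hard-fault index lies in `{j,…,j+m}` with `j+m ≤ 93`,
then `s_(m,j+m) = s_(0,j)`. -/
theorem shift_no_fault (k : TState) (F : Finset ℕ) (hF : F.Nonempty)
    (hsub : F ⊆ Finset.Icc 1 288)
    (j m : ℕ) (hj : 1 ≤ j) (hjm : j + m ≤ 93)
    (hdisj : F ∩ Finset.Icc j (j + m) = ∅) :
    traj F k m (j + m) = traj F k 0 j := by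
  induction m with
  | zero => rfl
  | succ m ih =>
    have hmem : j + m + 1 ∉ F := fun h =>
      Finset.disjoint_left.mp (Finset.disjoint_iff_inter_eq_empty.mpr hdisj) h
        (Finset.mem_Icc.mpr ⟨by omega, by omega⟩)
    rw [← Nat.add_assoc, traj_succ_of_notMem k m (by omega) (by omega) hmem]
    refine ih (by omega) (Finset.subset_empty.mp (hdisj ▸ ?_))
    exact Finset.inter_subset_inter_left (Finset.Icc_subset_Icc_right (by omega))
end

section
/- (Proposition 4) Assume Case 3. Define a_{t+1} = s_(t,66) + s_(t,91)·s_(t,92) + s_(t,93) for every t ≥ 0. Suppose a_{t+1} = 1 for some t with 0 ≤ t ≤ 11. Then a_{i+1} = k_{66-i} for every 0 ≤ i ≤ t, i.e. (a_1, a_2, …, a_{t+1}) = (k_66, k_65, …, k_{66-t}). -/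
/-- While the entry at position `j` of the first register still comes from the loading state, it is
the loaded entry if no faulty position lies on its way, and `0` otherwise. -/
theorem traj_first_register_s15 (F : Finset ℕ) (k : TState) (t j : ℕ) (htj : t < j) (hj : j ≤ 93) :
    traj F k t j =
      if ∃ f ∈ F, j ≤ f + t ∧ f ≤ j then 0 else loadIV k (fun _ => 0) (j - t) := by
  induction t generalizing j with
  | zero =>
    have h : (∃ f ∈ F, j ≤ f + 0 ∧ f ≤ j) ↔ j ∈ F := by grind
    simp only [h, Nat.sub_zero]
    rfl
  | succ t ih =>
    have hstep : traj F k (t + 1) j = if j ∈ F then 0 else traj F k t (j - 1) := by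
      change (if j ∈ F then 0 else trivT (traj F k t) j) = _
      simp only [trivT, if_neg (show j ≠ 1 by lia), if_pos hj]
    rw [hstep, ih (j - 1) (by lia) (by lia), Nat.sub_sub, Nat.add_comm 1 t]
    have h : (∃ f ∈ F, j ≤ f + (t + 1) ∧ f ≤ j) ↔
        j ∈ F ∨ ∃ f ∈ F, j - 1 ≤ f + t ∧ f ≤ j - 1 := by
      constructor
      · rintro ⟨f, hf, h₁, h₂⟩
        rcases h₂.eq_or_lt with rfl | h₃
        · exact .inl hf
        · exact .inr ⟨f, hf, by lia, by lia⟩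
      · rintro (hjF | ⟨f, hf, h₁, h₂⟩)
        · exact ⟨j, hjF, by lia, le_rfl⟩
        · exact ⟨f, hf, by lia, by lia⟩
    simp only [h, ite_or]

/-- An entry of the first register that comes from the zero padding of the key is `0`. -/
theorem traj_eq_zero_of_padding (F : Finset ℕ) (k : TState) (t j : ℕ) (htj : t + 80 < j)
    (hj : j ≤ 93) : traj F k t j = 0 := by
  rw [traj_first_register_s15 F k t j (by lia) hj]
  simp only [loadIV, if_neg (show j - t ≠ 0 by lia), if_neg (show ¬ j - t ≤ 80 by lia),
    if_pos (show j - t ≤ 93 by lia), ite_self]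

theorem aSeq_of_le_eleven (F : Finset ℕ) (k : TState) (t : ℕ) (ht : t ≤ 11) :
    aSeq F k t = if ∃ f ∈ F, 66 ≤ f + t ∧ f ≤ 66 then 0 else k (66 - t) := by
  rw [aSeq, traj_eq_zero_of_padding F k t 92 (by lia) (by lia),
    traj_eq_zero_of_padding F k t 93 (by lia) (by lia), mul_zero, add_zero, add_zero,
    traj_first_register_s15 F k t 66 (by lia) (by lia)]
  simp only [loadIV, if_neg (show 66 - t ≠ 0 by lia), if_pos (show 66 - t ≤ 80 by lia)]

/-- Proposition 4 (Case 3), with `aSeq t = a_{t+1}`. -/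
theorem case3_prop4 (k : TState) (F : Finset ℕ) (hF : F.Nonempty)
    (hsub : F ⊆ Finset.Icc 1 93)
    (hlo : 1 ≤ F.min' hF) (hhi : F.min' hF ≤ 66)
    (t : ℕ) (ht : t ≤ 11) (ha : aSeq F k t = 1) :
    ∀ i, i ≤ t → aSeq F k i = k (66 - i) := by
  intro i hi
  rw [aSeq_of_le_eleven F k t ht] at ha
  rw [aSeq_of_le_eleven F k i (hi.trans ht), if_neg]
  rintro ⟨f, hf, h₁, h₂⟩
  rw [if_pos ⟨f, hf, by lia, h₂⟩] at ha
  exact zero_ne_one ha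
end

section
/- (Proposition 6, parts 1 and 4) Assume Case 4. Then: (1) for every t ≥ 0 and every j with 171 ≤ j ≤ 177, s_(t,j) = 0, so that z_m = s_(m+1152,66) + s_(m+1152,93) + s_(m+1152,162) + s_(m+1152,243) + s_(m+1152,288) for every m ≥ 0; (2) let IV' ∈ (ZMod 2)^80 be given by IV'_70 = 1 and IV'_j = 0 for all j ≠ 70; then the key-stream is unchanged under this change of IV: z_m(IV') = z_m(0) for every m ≥ 0. -/
/-- If `p ∈ F` lies in the second register and the loading state vanishes on `(p, 177]`, then
the trajectory vanishes on `[p, 177]` at all times. -/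
theorem trajIV_eq_zero {F : Finset ℕ} {k IV : TState} {p : ℕ} (hp : p ∈ F) (hp94 : 94 ≤ p)
    (h0 : ∀ j, p < j → j ≤ 177 → loadIV k IV j = 0) (t j : ℕ) (hpj : p ≤ j) (hj : j ≤ 177) :
    trajIV F k IV t j = 0 := by
  rcases hpj.eq_or_lt with rfl | hlt
  · cases t <;> simp [trajIV, zapF, hp]
  induction t generalizing j with
  | zero => simp [trajIV, zapF, h0 j hlt hj]
  | succ t ih =>
    have hprev : trajIV F k IV t (j - 1) = 0 := by
      rcases (Nat.le_sub_one_of_lt hlt).eq_or_lt with h | h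
      · rw [← h]
        cases t <;> simp [trajIV, zapF, hp]
      · exact ih (j - 1) (by omega) (by omega) h
    have hstep : trivT (trajIV F k IV t) j = 0 := by
      simp only [trivT]
      split_ifs <;> omega
    simp [trajIV, zapF, hstep]

/-- If `p ∈ F` with `p ≤ 171` and two loading states agree outside `[163, p]`, then the
two trajectories agree outside `[163, p)`. -/
theorem trajIV_congr {F : Finset ℕ} {k IV IV' : TState} {p : ℕ} (hp : p ∈ F)
    (hhi : p ≤ 171)
    (h0 : ∀ j, j < 163 ∨ p < j → loadIV k IV j = loadIV k IV' j)
    (t j : ℕ) (hj : j < 163 ∨ p ≤ j) :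
    trajIV F k IV t j = trajIV F k IV' t j := by
  induction t generalizing j with
  | zero =>
    simp only [trajIV, zapF]
    split_ifs with hjF
    · rfl
    · have : j ≠ p := fun h => hjF (h ▸ hp)
      exact h0 j (by omega)
  | succ t ih =>
    simp only [trajIV, zapF]
    split_ifs with hjF
    · rfl
    · have : j ≠ p := fun h => hjF (h ▸ hp)
      have hprev := ih (j - 1) (by omega)
      have hlow : ∀ i, i < 163 → trajIV F k IV t i = trajIV F k IV' t i :=
        fun i hi => ih i (Or.inl hi)
      have hhigh : ∀ i, 171 ≤ i → trajIV F k IV t i = trajIV F k IV' t i :=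
        fun i hi => ih i (Or.inr (hhi.trans hi))
      simp only [trivT, hprev]
      simp (disch := norm_num) only [hlow, hhigh]

/-- Proposition 6, parts 1 and 4 (Case 4). -/
theorem case4_degraded (k : TState) (F : Finset ℕ) (hF : F.Nonempty)
    (hsub : F ⊆ Finset.Icc 94 177)
    (hlo : 163 ≤ F.min' hF) (hhi : F.min' hF ≤ 171) :
    ((∀ t, ∀ j, 171 ≤ j → j ≤ 177 → traj F k t j = 0) ∧
     (∀ m : ℕ, ks F k m =
        traj F k (m + 1152) 66 + traj F k (m + 1152) 93 + traj F k (m + 1152) 162 +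
          traj F k (m + 1152) 243 + traj F k (m + 1152) 288)) ∧
    (∀ m : ℕ, ksIV F k (fun j => if j = 70 then 1 else 0) m = ks F k m) := by
  have hp := F.min'_mem hF
  have hzero : ∀ t, ∀ j, 171 ≤ j → j ≤ 177 → traj F k t j = 0 := fun t j h₁ h₂ =>
    trajIV_eq_zero hp (by omega)
      (fun i hi hi' => by simp only [loadIV]; split_ifs <;> first | rfl | omega)
      t j (hhi.trans h₁) h₂
  refine ⟨⟨hzero, fun m => ?_⟩, fun m => ?_⟩
  · have h := hzero (m + 1152) 177 (by norm_num) le_rfl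
    simp only [traj] at h ⊢
    simp only [ks, ksIV, h, add_zero]
  · have hcongr := trajIV_congr (k := k) (IV := fun j => if j = 70 then 1 else 0)
      (IV' := fun _ => 0) hp hhi
      (fun j hj => by simp only [loadIV]; split_ifs <;> first | rfl | omega) (m + 1152)
    simp only [ks, ksIV]
    rw [hcongr 66 (by omega), hcongr 93 (by omega), hcongr 162 (by omega),
      hcongr 177 (by omega), hcongr 243 (by omega), hcongr 288 (by omega)]
end

section
/- (Lemma 16, part 1) Assume Case 5. Then for every t ≥ 5, s_(t,176) = 0 and s_(t,177) = 0. -/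
/-- The register cells from a faulted cell `p` in `95, …, 177` up to `177` stay zero when `IV = 0`:
they are loaded with zeros, and each one is fed only by its predecessor. -/
theorem traj_eq_zero_of_mem_of_le (F : Finset ℕ) (k : TState) {p : ℕ} (hp : p ∈ F)
    (hp95 : 95 ≤ p) (t : ℕ) : ∀ j, p ≤ j → j ≤ 177 → traj F k t j = 0 := by
  induction t with
  | zero =>
    intro j hpj hj
    simp only [traj, trajIV, zapF, loadIV]
    grind
  | succ t ih =>
    intro j hpj hj
    by_cases hjF : j ∈ F
    · simp [traj, trajIV, zapF, hjF]
    · have hne : j ≠ p := fun h => hjF (h ▸ hp)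
      have hprev : traj F k t (j - 1) = 0 := ih (j - 1) (by omega) (by omega)
      simp only [traj, trajIV, zapF, trivT] at hprev ⊢
      grind

/-- Lemma 16, part 1 (Case 5). -/
theorem case5_tail_zero (k : TState) (F : Finset ℕ) (hF : F.Nonempty)
    (hsub : F ⊆ Finset.Icc 94 177)
    (hlo : 172 ≤ F.min' hF) (hhi : F.min' hF ≤ 176) :
    ∀ t, 5 ≤ t → traj F k t 176 = 0 ∧ traj F k t 177 = 0 := by
  intro t _
  have hzero := traj_eq_zero_of_mem_of_le F k (F.min'_mem hF) (by omega) t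
  exact ⟨hzero 176 (by omega) (by omega), hzero 177 (by omega) (by omega)⟩
end

section
/- (Lemma 17) Assume Case 5, and let m ≥ 0 be such that for every t ≥ m, s_(t,176) = 0 and s_(t,177) = 0. Then for every i with 1 ≤ i ≤ 9 and every t ≥ m + i, s_(t,162+i) + s_(t,177+i) + s_(t,264+i) = 0; in particular, for every t ≥ m+1, s_(t,163) + s_(t,178) + s_(t,265) = 0, and for every t ≥ m+9, s_(t,171) + s_(t,186) + s_(t,273) = 0. -/
/-- Outside `F` and the three feedback positions, one step of the trajectory is a shift. -/
theorem traj_succ_shift (F : Finset ℕ) (k : TState) (t j : ℕ) (hj : j + 1 ∉ F)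
    (h1 : j ≠ 0) (h94 : j ≠ 93) (h178 : j ≠ 177) (h288 : j < 288) :
    traj F k (t + 1) (j + 1) = traj F k t j := by
  simp only [traj, trajIV, zapF, trivT, if_neg hj, Nat.add_sub_cancel]
  split_ifs <;> first | rfl | omega

/-- The feedback into position 178 when that position is not faulted. -/
theorem traj_succ_178 (F : Finset ℕ) (k : TState) (t : ℕ) (h : 178 ∉ F) :
    traj F k (t + 1) 178 =
      traj F k t 162 + traj F k t 175 * traj F k t 176 + traj F k t 177 + traj F k t 264 := by
  simp [traj, trajIV, zapF, trivT, h]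

/-- Lemma 17 (Case 5). -/
theorem case5_linear_relations (k : TState) (F : Finset ℕ) (hF : F.Nonempty)
    (hsub : F ⊆ Finset.Icc 94 177)
    (hlo : 172 ≤ F.min' hF) (hhi : F.min' hF ≤ 176)
    (m : ℕ) (hm : ∀ t, m ≤ t → traj F k t 176 = 0 ∧ traj F k t 177 = 0) :
    (∀ i, 1 ≤ i → i ≤ 9 → ∀ t, m + i ≤ t →
        traj F k t (162 + i) + traj F k t (177 + i) + traj F k t (264 + i) = 0) ∧
    (∀ t, m + 1 ≤ t → traj F k t 163 + traj F k t 178 + traj F k t 265 = 0) ∧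
    (∀ t, m + 9 ≤ t → traj F k t 171 + traj F k t 186 + traj F k t 273 = 0) := by
  have hmin : ∀ j ∈ F, 172 ≤ j := fun j hj => hlo.trans (F.min'_le j hj)
  have hmax : ∀ j ∈ F, j ≤ 177 := fun j hj => (Finset.mem_Icc.1 (hsub hj)).2
  have below : ∀ j, j < 172 → j ∉ F := fun j h hj => absurd (hmin j hj) (by omega)
  have above : ∀ j, 177 < j → j ∉ F := fun j h hj => absurd (hmax j hj) (by omega)
  have key : ∀ i, 1 ≤ i → i ≤ 9 → ∀ t, m + i ≤ t →
      traj F k t (162 + i) + traj F k t (177 + i) + traj F k t (264 + i) = 0 := by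
    intro i hi
    induction i, hi using Nat.le_induction with
    | base =>
      intro _ t ht
      obtain ⟨t, rfl⟩ : ∃ u, t = u + 1 := ⟨t - 1, by omega⟩
      obtain ⟨h176, h177⟩ := hm t (by omega)
      rw [traj_succ_shift F k t 162 (below _ (by omega)) (by omega) (by omega) (by omega)
          (by omega),
        traj_succ_shift F k t 264 (above _ (by omega)) (by omega) (by omega) (by omega)
          (by omega),
        traj_succ_178 F k t (above _ (by omega)), h176, h177, mul_zero, add_zero, add_zero]
      linear_combination CharTwo.add_self_eq_zero (traj F k t 162) +
        CharTwo.add_self_eq_zero (traj F k t 264)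
    | succ i hi ih =>
      intro hi9 t ht
      obtain ⟨t, rfl⟩ : ∃ u, t = u + 1 := ⟨t - 1, by omega⟩
      rw [← add_assoc, ← add_assoc, ← add_assoc,
        traj_succ_shift F k t (162 + i) (below _ (by omega)) (by omega) (by omega) (by omega)
          (by omega),
        traj_succ_shift F k t (177 + i) (above _ (by omega)) (by omega) (by omega) (by omega)
          (by omega),
        traj_succ_shift F k t (264 + i) (above _ (by omega)) (by omega) (by omega) (by omega)
          (by omega)]
      exact ih (by omega) t (by omega)
  exact ⟨key, key 1 le_rfl (by omega), key 9 (by omega) le_rfl⟩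
end
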